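/- In the synchronous closure Π_s of a deterministic interface, for every trace τ ∈ Π_s and every input symbol i ∈ Σ̃ᵢ, there is exactly one output symbol o ∈ Σ̃ₒ such that τ·i·o ∈ Π_s. -/

import Mathlib

/-- Extended output alphabet `Σ̃ₒ = Σₒ ∪ {quiet, λ, err}`. -/
inductive TOut (O : Type) where
  | out : O → TOut O
  | quiet : TOut O
  | lam : TOut O
  | err : TOut O

/-- A synchronous word in `(Σ̃ᵢ · Σ̃ₒ)*` is a list of pairs of an input
(`some i` is a callin, `none` is `wait`) and an extended output. -/
abbrev SynWord (I O : Type) := List (Option I × TOut O)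

/-- `async` erases all occurrences of `wait`, `quiet`, `λ` and `err`,
yielding a word over `Σᵢ ∪ Σₒ`. -/
def async {I O : Type} (τ : SynWord I O) : List (I ⊕ O) :=
  τ.foldr (fun p r =>
    (match p.1 with | some i => [Sum.inl i] | none => []) ++
    (match p.2 with | TOut.out o => [Sum.inr o] | _ => []) ++ r) []

/-- The synchronous word ends with the output `err`. -/
def endsErr {I O : Type} (τ : SynWord I O) : Prop :=
  ∃ x : Option I, τ.getLast? = some (x, TOut.err)

/-- The synchronous closure `Π_s`, where the `err`-ending clause
overrides the others. -/
inductive SynClosure {I O : Type} (Pi : Set (List (I ⊕ O))) : SynWord I O → Prop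
  | nil : SynClosure Pi []
  | callin (τ : SynWord I O) (i : I) :
      SynClosure Pi τ → ¬ endsErr τ → (async τ ++ [Sum.inl i]) ∈ Pi →
      SynClosure Pi (τ ++ [(some i, TOut.lam)])
  | callback (τ : SynWord I O) (o : O) :
      SynClosure Pi τ → ¬ endsErr τ → (async τ ++ [Sum.inr o]) ∈ Pi →
      SynClosure Pi (τ ++ [(none, TOut.out o)])
  | errin (τ : SynWord I O) (i : I) :
      SynClosure Pi τ → ¬ endsErr τ → (async τ ++ [Sum.inl i]) ∉ Pi →
      SynClosure Pi (τ ++ [(some i, TOut.err)])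
  | quiet (τ : SynWord I O) :
      SynClosure Pi τ → ¬ endsErr τ →
      (∀ o : O, (async τ ++ [Sum.inr o]) ∉ Pi) →
      SynClosure Pi (τ ++ [(none, TOut.quiet)])
  | errprop (τ : SynWord I O) (x : Option I) :
      SynClosure Pi τ → endsErr τ →
      SynClosure Pi (τ ++ [(x, TOut.err)])

/-- Inversion of a one-step extension in the synchronous closure. -/
theorem SynClosure_inv {I O : Type} {Pi : Set (List (I ⊕ O))} {τ : SynWord I O}
    {x : Option I} {o : TOut O} (h : SynClosure Pi (τ ++ [(x, o)])) :
    (¬ endsErr τ ∧ ∃ i, x = some i ∧ o = TOut.lam ∧ (async τ ++ [Sum.inl i]) ∈ Pi) ∨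
    (¬ endsErr τ ∧ ∃ b, x = none ∧ o = TOut.out b ∧ (async τ ++ [Sum.inr b]) ∈ Pi) ∨
    (¬ endsErr τ ∧ ∃ i, x = some i ∧ o = TOut.err ∧ (async τ ++ [Sum.inl i]) ∉ Pi) ∨
    (¬ endsErr τ ∧ x = none ∧ o = TOut.quiet ∧ ∀ b : O, (async τ ++ [Sum.inr b]) ∉ Pi) ∨
    (endsErr τ ∧ o = TOut.err) := by
  generalize hw : τ ++ [(x, o)] = w at h
  cases h with
  | nil => simp at hw
  | callin τ' i h1 h2 h3 =>
    obtain ⟨rfl, h⟩ := List.append_inj' hw rfl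
    simp only [List.cons.injEq, Prod.mk.injEq, and_true] at h
    exact Or.inl ⟨h2, i, h.1, h.2, h3⟩
  | callback τ' b h1 h2 h3 =>
    obtain ⟨rfl, h⟩ := List.append_inj' hw rfl
    simp only [List.cons.injEq, Prod.mk.injEq, and_true] at h
    exact Or.inr (Or.inl ⟨h2, b, h.1, h.2, h3⟩)
  | errin τ' i h1 h2 h3 =>
    obtain ⟨rfl, h⟩ := List.append_inj' hw rfl
    simp only [List.cons.injEq, Prod.mk.injEq, and_true] at h
    exact Or.inr (Or.inr (Or.inl ⟨h2, i, h.1, h.2, h3⟩))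
  | quiet τ' h1 h2 h3 =>
    obtain ⟨rfl, h⟩ := List.append_inj' hw rfl
    simp only [List.cons.injEq, Prod.mk.injEq, and_true] at h
    exact Or.inr (Or.inr (Or.inr (Or.inl ⟨h2, h.1, h.2, h3⟩)))
  | errprop τ' y h1 h2 =>
    obtain ⟨rfl, h⟩ := List.append_inj' hw rfl
    simp only [List.cons.injEq, Prod.mk.injEq, and_true] at h
    exact Or.inr (Or.inr (Or.inr (Or.inr ⟨h2, h.2⟩)))

theorem stmt_13 {I O : Type} (Pi : Set (List (I ⊕ O)))
    (hpc : ∀ τ ∈ Pi, ∀ p : List (I ⊕ O), p <+: τ → p ∈ Pi)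
    (hdet : ∀ τ ∈ Pi, ∀ o₁ o₂ : O,
      (τ ++ [Sum.inr o₁]) ∈ Pi → (τ ++ [Sum.inr o₂]) ∈ Pi → o₁ = o₂) :
    ∀ τ : SynWord I O, SynClosure Pi τ → ∀ x : Option I,
      ∃! o : TOut O, SynClosure Pi (τ ++ [(x, o)]) := by
  intro τ hτ x
  by_cases he : endsErr τ
  · refine ⟨TOut.err, SynClosure.errprop τ x hτ he, fun o ho => ?_⟩
    have := SynClosure_inv ho
    tauto
  · cases x with
    | some i =>
      by_cases hi : (async τ ++ [Sum.inl i]) ∈ Pi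
      · refine ⟨TOut.lam, SynClosure.callin τ i hτ he hi, fun o ho => ?_⟩
        rcases SynClosure_inv ho with ⟨_, j, hj, h, _⟩ | ⟨_, b, hb, _⟩ | ⟨_, j, hj, _, h⟩ |
          ⟨_, h, _⟩ | ⟨h, _⟩
        · exact h
        · cases hb
        · cases hj; exact absurd hi h
        · cases h
        · exact absurd h he
      · refine ⟨TOut.err, SynClosure.errin τ i hτ he hi, fun o ho => ?_⟩
        rcases SynClosure_inv ho with ⟨_, j, hj, _, h⟩ | ⟨_, b, hb, _⟩ | ⟨_, j, hj, h, _⟩ |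
          ⟨_, h, _⟩ | ⟨h, _⟩
        · cases hj; exact absurd h hi
        · cases hb
        · exact h
        · cases h
        · exact absurd h he
    | none =>
      by_cases hb : ∃ b : O, (async τ ++ [Sum.inr b]) ∈ Pi
      · obtain ⟨b, hb⟩ := hb
        refine ⟨TOut.out b, SynClosure.callback τ b hτ he hb, fun o ho => ?_⟩
        rcases SynClosure_inv ho with ⟨_, j, hj, _⟩ | ⟨_, c, _, h, hc⟩ | ⟨_, j, hj, _⟩ |
          ⟨_, _, _, h⟩ | ⟨h, _⟩
        · cases hj
        · rw [h, hdet _ (hpc _ hb _ (List.prefix_append _ _)) c b hc hb]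
        · cases hj
        · exact absurd hb (h b)
        · exact absurd h he
      · have hq : ∀ b : O, (async τ ++ [Sum.inr b]) ∉ Pi := fun b h => hb ⟨b, h⟩
        refine ⟨TOut.quiet, SynClosure.quiet τ hτ he hq, fun o ho => ?_⟩
        rcases SynClosure_inv ho with ⟨_, j, hj, _⟩ | ⟨_, c, _, _, hc⟩ | ⟨_, j, hj, _⟩ |
          ⟨_, _, h, _⟩ | ⟨h, _⟩
        · cases hj
        · exact absurd hc (hq c)
        · cases hj
        · exact h
        · exact absurd h he
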